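/- Let m = (a₁, a₂, b, c) be an ADHM configuration with a₂ nilpotent, and let β₁, β₃ ∈ ℂ. Define the linear map 𝔄₂ : W ⊕ ℂʳ → W ⊕ W ⊕ ℂʳ by 𝔄₂(ξ, u) = ((β₁ − β₃a₁)ξ + β₃(1 − β₃a₂)⁻¹(b u), (1 − β₃a₂)ξ, β₃·c(ξ) + u). Then 𝔄₂ is injective and its range is exactly ker B_m(β₁, 1, β₃). -/

import Mathlib

/-- The monad map `B_m(x₁,x₂,x₃) : W ⊕ W ⊕ ℂʳ → W` of an ADHM configuration. -/
noncomputable def adhmB {W : Type*} [AddCommGroup W] [Module ℂ W] {r : ℕ}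
    (a₁ a₂ : W →ₗ[ℂ] W) (b : (Fin r → ℂ) →ₗ[ℂ] W) (x₁ x₂ x₃ : ℂ) :
    (W × W × (Fin r → ℂ)) →ₗ[ℂ] W :=
  (x₃ • a₂ - x₂ • LinearMap.id).comp (LinearMap.fst ℂ W (W × (Fin r → ℂ)))
    + (x₁ • LinearMap.id - x₃ • a₁).comp
        ((LinearMap.fst ℂ W (Fin r → ℂ)).comp (LinearMap.snd ℂ W (W × (Fin r → ℂ))))
    + (x₃ • b).comp
        ((LinearMap.snd ℂ W (Fin r → ℂ)).comp (LinearMap.snd ℂ W (W × (Fin r → ℂ))))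

/-- The map `𝔄₂ : W ⊕ ℂʳ → W ⊕ W ⊕ ℂʳ`,
`(ξ, u) ↦ ((β₁ − β₃a₁)ξ + β₃(1 − β₃a₂)⁻¹(b u), (1 − β₃a₂)ξ, β₃·c(ξ) + u)`. -/
noncomputable def frakA2 {W : Type*} [AddCommGroup W] [Module ℂ W] {r : ℕ}
    (a₁ a₂ : Module.End ℂ W) (b : (Fin r → ℂ) →ₗ[ℂ] W) (c : W →ₗ[ℂ] (Fin r → ℂ))
    (β₁ β₃ : ℂ) :
    (W × (Fin r → ℂ)) →ₗ[ℂ] (W × W × (Fin r → ℂ)) :=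
  LinearMap.prod
    ((β₁ • (1 : Module.End ℂ W) - β₃ • a₁) ∘ₗ LinearMap.fst ℂ W (Fin r → ℂ)
      + (β₃ • (Ring.inverse ((1 : Module.End ℂ W) - β₃ • a₂) ∘ₗ b))
          ∘ₗ LinearMap.snd ℂ W (Fin r → ℂ))
    (LinearMap.prod
      (((1 : Module.End ℂ W) - β₃ • a₂) ∘ₗ LinearMap.fst ℂ W (Fin r → ℂ))
      ((β₃ • c) ∘ₗ LinearMap.fst ℂ W (Fin r → ℂ) + LinearMap.snd ℂ W (Fin r → ℂ)))

theorem frakA2_apply {W : Type*} [AddCommGroup W] [Module ℂ W] {r : ℕ}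
    (a₁ a₂ : Module.End ℂ W) (b : (Fin r → ℂ) →ₗ[ℂ] W) (c : W →ₗ[ℂ] (Fin r → ℂ))
    (β₁ β₃ : ℂ) (ξ : W) (u : Fin r → ℂ) :
    frakA2 a₁ a₂ b c β₁ β₃ (ξ, u) =
      (β₁ • ξ - β₃ • a₁ ξ + β₃ • Ring.inverse (1 - β₃ • a₂) (b u), ξ - β₃ • a₂ ξ,
        β₃ • c ξ + u) := by
  simp [frakA2]

theorem adhmB_apply {W : Type*} [AddCommGroup W] [Module ℂ W] {r : ℕ}
    (a₁ a₂ : Module.End ℂ W) (b : (Fin r → ℂ) →ₗ[ℂ] W) (x₁ x₂ x₃ : ℂ)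
    (v₁ v₂ : W) (u : Fin r → ℂ) :
    adhmB a₁ a₂ b x₁ x₂ x₃ (v₁, v₂, u) =
      x₃ • a₂ v₁ - x₂ • v₁ + (x₁ • v₂ - x₃ • a₁ v₂) + x₃ • b u := by
  simp [adhmB]

theorem adhmB_frakA2 {W : Type*} [AddCommGroup W] [Module ℂ W] {r : ℕ}
    (a₁ a₂ : Module.End ℂ W) (b : (Fin r → ℂ) →ₗ[ℂ] W) (c : W →ₗ[ℂ] (Fin r → ℂ))
    (hint : a₁ * a₂ - a₂ * a₁ + b ∘ₗ c = 0) (β₁ β₃ : ℂ) (hP : IsUnit (1 - β₃ • a₂))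
    (p : W × (Fin r → ℂ)) :
    adhmB a₁ a₂ b β₁ 1 β₃ (frakA2 a₁ a₂ b c β₁ β₃ p) = 0 := by
  obtain ⟨ξ, u⟩ := p
  have hinv : Ring.inverse (1 - β₃ • a₂) (b u)
      = b u + β₃ • a₂ (Ring.inverse (1 - β₃ • a₂) (b u)) := by
    have h := LinearMap.congr_fun (Ring.mul_inverse_cancel _ hP) (b u)
    simp only [Module.End.mul_apply, LinearMap.sub_apply, LinearMap.smul_apply,
      Module.End.one_apply] at h
    exact sub_eq_iff_eq_add.mp h
  have hξ : b (c ξ) = a₂ (a₁ ξ) - a₁ (a₂ ξ) := by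
    have h := LinearMap.congr_fun hint ξ
    simp only [LinearMap.add_apply, LinearMap.sub_apply, Module.End.mul_apply,
      LinearMap.comp_apply, LinearMap.zero_apply] at h
    rw [eq_neg_of_add_eq_zero_right h, neg_sub]
  rw [frakA2_apply, adhmB_apply]
  generalize Ring.inverse (1 - β₃ • a₂) (b u) = y at hinv
  rw [← sub_eq_iff_eq_add] at hinv
  simp only [map_add, map_sub, map_smul, hξ, ← hinv]
  module

/-- For an ADHM configuration with `a₂` nilpotent, the map `𝔄₂` is
injective with range exactly `ker B_m(β₁, 1, β₃)`. -/
theorem frakA2_injective_range_eq_ker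
    {W : Type*} [AddCommGroup W] [Module ℂ W] [FiniteDimensional ℂ W]
    {r : ℕ} (hr : 1 ≤ r)
    (a₁ a₂ : Module.End ℂ W) (b : (Fin r → ℂ) →ₗ[ℂ] W) (c : W →ₗ[ℂ] (Fin r → ℂ))
    (hint : a₁ * a₂ - a₂ * a₁ + b ∘ₗ c = 0)
    (hn₂ : IsNilpotent a₂)
    (β₁ β₃ : ℂ) :
    Function.Injective (frakA2 a₁ a₂ b c β₁ β₃)
      ∧ LinearMap.range (frakA2 a₁ a₂ b c β₁ β₃)
          = LinearMap.ker (adhmB a₁ a₂ b β₁ 1 β₃) := by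
  have hP : IsUnit (1 - β₃ • a₂) := (hn₂.smul β₃).isUnit_one_sub
  have hbij := (Module.End.isUnit_iff _).mp hP
  refine ⟨(injective_iff_map_eq_zero _).mpr ?_, le_antisymm ?_ ?_⟩
  · rintro ⟨ξ, u⟩ h
    simp only [frakA2_apply, Prod.mk_eq_zero] at h
    obtain ⟨-, h₂, h₃⟩ := h
    obtain rfl : ξ = 0 := (injective_iff_map_eq_zero _).mp hbij.injective ξ (by simpa using h₂)
    simpa using h₃
  · rintro _ ⟨p, rfl⟩
    exact adhmB_frakA2 a₁ a₂ b c hint β₁ β₃ hP p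
  · rintro ⟨v₁, v₂, w⟩ hv
    obtain ⟨ξ, rfl⟩ := hbij.surjective v₂
    have h₀ := adhmB_frakA2 a₁ a₂ b c hint β₁ β₃ hP (ξ, w - β₃ • c ξ)
    refine ⟨(ξ, w - β₃ • c ξ), ?_⟩
    rw [LinearMap.mem_ker, adhmB_apply] at hv
    rw [frakA2_apply] at h₀ ⊢
    rw [adhmB_apply, add_sub_cancel] at h₀
    rw [add_sub_cancel]
    refine Prod.ext (hbij.injective ?_) (Prod.ext (by simp) rfl)
    simp only [LinearMap.sub_apply, LinearMap.smul_apply, Module.End.one_apply] at hv ⊢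
    linear_combination (norm := module) hv - h₀
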